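/- Let N ≥ 3, p ≥ 2, and let a₁, a₂ ∈ ℝ^N. Suppose φ > 0 on ℝ^N, φ ∈ C²(ℝ^N \ {a₁, a₂}), and V ∈ L¹_loc(ℝ^N) is continuous on ℝ^N \ {a₁, a₂} and satisfies −div(|∇φ|^{p−2}∇φ)(x) − V(x)φ(x)^{p−1} ≥ 0 for all x ∈ ℝ^N \ {a₁, a₂}. Then there exists a constant c₁(p) > 0, depending only on p, such that for every u ∈ C_c^∞(ℝ^N \ {a₁, a₂}): c₁(p) ∫_{ℝ^N} |∇(u/φ)|^p φ^p dx ≤ ∫_{ℝ^N} |∇u|^p dx − ∫_{ℝ^N} V|u|^p dx. -/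

import Mathlib

open MeasureTheory

noncomputable section

/-- Divergence of a vector field on Euclidean space. -/
def divg {N : ℕ} (X : EuclideanSpace ℝ (Fin N) → EuclideanSpace ℝ (Fin N))
    (x : EuclideanSpace ℝ (Fin N)) : ℝ :=
  ∑ i, fderiv ℝ X x (EuclideanSpace.single i 1) i

/-- The `p`-Laplacian `Δ_p φ = div(|∇φ|^{p-2} ∇φ)`. -/
def pLap {N : ℕ} (p : ℝ) (φ : EuclideanSpace ℝ (Fin N) → ℝ)
    (x : EuclideanSpace ℝ (Fin N)) : ℝ :=
  divg (fun y => ‖gradient φ y‖ ^ (p - 2) • gradient φ y) x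

end

section
variable {E : Type*} [NormedAddCommGroup E] [InnerProductSpace ℝ E]

/-- The tangent inequality for the convex function `‖·‖ ^ p`. -/
theorem norm_rpow_add_inner_le_norm_add_rpow {p : ℝ} (hp : 2 ≤ p) (a d : E) :
    ‖a‖ ^ p + p * ‖a‖ ^ (p - 2) * inner ℝ a d ≤ ‖a + d‖ ^ p := by
  rcases eq_or_ne a 0 with rfl | ha
  · have h : (0 : ℝ) ^ p = 0 := Real.zero_rpow (by linarith)
    simp only [norm_zero, h, inner_zero_left, mul_zero, zero_add]
    positivity
  have hna : 0 < ‖a‖ := norm_pos_iff.2 ha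
  set s : ℝ := (2 * inner ℝ a d + ‖d‖ ^ 2) / ‖a‖ ^ 2 with hs
  have hsq : ‖a + d‖ ^ 2 = ‖a‖ ^ 2 * (1 + s) := by
    rw [norm_add_sq_real, hs]; field_simp; ring
  have hs1 : -1 ≤ s := by
    have : 0 ≤ ‖a‖ ^ 2 * (1 + s) := hsq ▸ sq_nonneg _
    have := nonneg_of_mul_nonneg_right this (by positivity)
    linarith
  have hsq' : ∀ x : E, ‖x‖ ^ p = (‖x‖ ^ 2) ^ (p / 2) := fun x => by
    rw [← Real.rpow_natCast_mul (norm_nonneg _)]; congr 1; push_cast; ring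
  have hB := one_add_mul_self_le_rpow_one_add hs1 (p := p / 2) (by linarith)
  rw [hsq' (a + d), hsq, Real.mul_rpow (by positivity) (by linarith), ← hsq' a]
  have h2 : ‖a‖ ^ (p - 2) = ‖a‖ ^ p / ‖a‖ ^ 2 := by
    rw [Real.rpow_sub hna]; norm_cast
  have hP : 0 < ‖a‖ ^ p := by positivity
  calc ‖a‖ ^ p + p * ‖a‖ ^ (p - 2) * inner ℝ a d
      = ‖a‖ ^ p * (1 + p * inner ℝ a d / ‖a‖ ^ 2) := by rw [h2]; ring
    _ ≤ ‖a‖ ^ p * (1 + p / 2 * s) := by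
        gcongr
        rw [hs]
        have : p / 2 * ((2 * inner ℝ a d + ‖d‖ ^ 2) / ‖a‖ ^ 2)
          = p * inner ℝ a d / ‖a‖ ^ 2 + p / 2 * (‖d‖ ^ 2 / ‖a‖ ^ 2) := by ring
        rw [this]
        have : 0 ≤ p / 2 * (‖d‖ ^ 2 / ‖a‖ ^ 2) := by positivity
        linarith
    _ ≤ _ := by gcongr

/-- Clarkson's inequality in an inner product space, around a midpoint. -/
theorem two_mul_norm_rpow_add_norm_rpow_le {p : ℝ} (hp : 2 ≤ p) (x y : E) :
    2 * (‖x‖ ^ p + ‖y‖ ^ p) ≤ ‖x + y‖ ^ p + ‖x - y‖ ^ p := by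
  have hsq' : ∀ x : E, ‖x‖ ^ p = (‖x‖ ^ 2) ^ (p / 2) := fun x => by
    rw [← Real.rpow_natCast_mul (norm_nonneg _)]; congr 1; push_cast; ring
  have h1 := Real.add_rpow_le_rpow_add (sq_nonneg ‖x‖) (sq_nonneg ‖y‖) (p := p / 2) (by linarith)
  have h2 := (convexOn_rpow (p := p / 2) (by linarith)).2 (Set.mem_Ici.2 (sq_nonneg ‖x + y‖))
    (Set.mem_Ici.2 (sq_nonneg ‖x - y‖)) (show (0 : ℝ) ≤ 1 / 2 by norm_num)
    (show (0 : ℝ) ≤ 1 / 2 by norm_num) (by norm_num)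
  have h3 : (1 / 2 : ℝ) • ‖x + y‖ ^ 2 + (1 / 2 : ℝ) • ‖x - y‖ ^ 2 = ‖x‖ ^ 2 + ‖y‖ ^ 2 := by
    rw [norm_add_sq_real, norm_sub_sq_real]; simp only [smul_eq_mul]; ring
  rw [h3] at h2
  simp only [smul_eq_mul] at h2
  simp only [hsq']
  linarith

/-- Quantitative tangent inequality for `‖·‖ ^ p`, with uniform convexity remainder. -/
theorem norm_rpow_add_inner_add_le_norm_add_rpow {p : ℝ} (hp : 2 ≤ p) (a b : E) :
    ‖a‖ ^ p + p * ‖a‖ ^ (p - 2) * inner ℝ a b + 2 * (1 / 2 : ℝ) ^ p * ‖b‖ ^ p ≤ ‖a + b‖ ^ p := by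
  have h1 := norm_rpow_add_inner_le_norm_add_rpow hp a ((1 / 2 : ℝ) • b)
  have h2 := two_mul_norm_rpow_add_norm_rpow_le hp (a + (1 / 2 : ℝ) • b) ((1 / 2 : ℝ) • b)
  have e1 : a + (1 / 2 : ℝ) • b + (1 / 2 : ℝ) • b = a + b := by module
  rw [e1, add_sub_cancel_right, norm_smul, Real.mul_rpow (norm_nonneg _) (norm_nonneg _)] at h2
  rw [inner_smul_right] at h1
  have e2 : ‖(1 / 2 : ℝ)‖ = 1 / 2 := by norm_num
  rw [e2] at h2
  linarith

/-- The map `w ↦ ‖w‖ ^ q • w` is `C¹` for every `q ≥ 0`. -/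
theorem contDiff_norm_rpow_smul {q : ℝ} (hq : 0 ≤ q) :
    ContDiff ℝ 1 (fun w : E => ‖w‖ ^ q • w) := by
  rcases hq.eq_or_lt with rfl | hq
  · simpa using contDiff_fun_id
  have hnz : ∀ w : E, w ≠ 0 → ContDiffAt ℝ 1 (fun w : E => ‖w‖ ^ q • w) w := fun w hw =>
    (((contDiffAt_norm ℝ hw).rpow_const_of_ne (norm_ne_zero_iff.2 hw)).smul contDiffAt_id)
  have h0 : HasFDerivAt (fun w : E => ‖w‖ ^ q • w) (0 : E →L[ℝ] E) 0 := by
    refine .of_isLittleO ?_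
    have h : (fun w : E => ‖w‖ ^ q) =o[nhds 0] (fun _ => (1 : ℝ)) := by
      refine (Asymptotics.isLittleO_const_iff one_ne_zero).2 ?_
      have := (continuous_norm.rpow_const (fun _ => Or.inr hq.le)).tendsto (0 : E)
      simpa [hq.ne'] using this
    simpa using h.smul_isBigO (Asymptotics.isBigO_refl (fun w : E => w) (nhds 0))
  have hd : ∀ w : E, ‖fderiv ℝ (fun w : E => ‖w‖ ^ q • w) w‖ ≤ (1 + q) * ‖w‖ ^ q := by
    intro w
    rcases eq_or_ne w 0 with rfl | hw
    · rw [h0.fderiv, norm_zero]; positivity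
    have hn : 0 < ‖w‖ := norm_pos_iff.2 hw
    have hr : HasFDerivAt (fun w : E => ‖w‖ ^ q) ((q * ‖w‖ ^ (q - 2)) • innerSL ℝ w) w := by
      apply HasStrictFDerivAt.hasFDerivAt
      convert! (hasStrictFDerivAt_norm_sq w).rpow_const (p := q / 2) (by simp [hw]) using 0
      simp_rw [← Real.rpow_natCast_mul (norm_nonneg _), ← Nat.cast_smul_eq_nsmul ℝ, smul_smul]
      ring_nf
    rw [(hr.fun_smul (show HasFDerivAt (fun y : E => y) (ContinuousLinearMap.id ℝ E) w from
      hasFDerivAt_id w)).fderiv]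
    refine (norm_add_le _ _).trans ?_
    rw [add_mul, one_mul]
    refine add_le_add ?_ ?_
    · rw [norm_smul, Real.norm_of_nonneg (by positivity)]
      exact mul_le_of_le_one_right (by positivity) ContinuousLinearMap.norm_id_le
    · rw [ContinuousLinearMap.norm_smulRight_apply, norm_smul, innerSL_apply_norm,
        Real.norm_of_nonneg (by positivity), Real.rpow_sub hn]
      apply le_of_eq
      norm_cast
      field_simp
  rw [contDiff_one_iff_fderiv]
  refine ⟨fun w => ?_, continuous_iff_continuousAt.2 fun w => ?_⟩
  · rcases eq_or_ne w 0 with rfl | hw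
    · exact h0.differentiableAt
    · exact (hnz w hw).differentiableAt one_ne_zero
  · rcases eq_or_ne w 0 with rfl | hw
    · rw [ContinuousAt, h0.fderiv]
      refine squeeze_zero_norm hd ?_
      have := ((continuous_norm.rpow_const (fun _ => Or.inr hq.le)).const_mul (1 + q)).tendsto
        (0 : E)
      simpa [hq.ne'] using this
    · exact ((hnz w hw).fderiv_right (m := 0) (by simp)).continuousAt
end

section
variable {N : ℕ}

local notation "𝔼" => EuclideanSpace ℝ (Fin N)

theorem divg_smul {g : 𝔼 → ℝ} {g' : 𝔼 →L[ℝ] ℝ} {X : 𝔼 → 𝔼} {x : 𝔼} (hg : HasFDerivAt g g' x)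
    (hX : DifferentiableAt ℝ X x) :
    divg (fun y => g y • X y) x = g x * divg X x + g' (X x) := by
  unfold divg
  rw [(hg.fun_smul hX.hasFDerivAt).fderiv, Finset.mul_sum]
  have hsum : g' (X x) = ∑ i, g' (EuclideanSpace.single i 1) * X x i := by
    conv_lhs => rw [← (EuclideanSpace.basisFun (Fin N) ℝ).sum_repr (X x)]
    simp [mul_comm]
  rw [hsum, ← Finset.sum_add_distrib]
  simp

theorem continuous_divg {Y : 𝔼 → 𝔼} (hY : ContDiff ℝ 1 Y) : Continuous (divg Y) := by
  have h := hY.continuous_fderiv one_ne_zero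
  unfold divg
  fun_prop

theorem divg_eq_zero_of_notMem_tsupport {Y : 𝔼 → 𝔼} {x : 𝔼} (hx : x ∉ tsupport Y) :
    divg Y x = 0 := by
  simp [divg, image_eq_zero_of_notMem_tsupport fun h => hx (tsupport_fderiv_subset ℝ h)]

theorem integrable_divg {Y : 𝔼 → 𝔼} (hY : ContDiff ℝ 1 Y) (hc : HasCompactSupport Y) :
    Integrable (divg Y) :=
  (continuous_divg hY).integrable_of_hasCompactSupport <|
    HasCompactSupport.intro hc fun _ => divg_eq_zero_of_notMem_tsupport

/-- Divergence theorem for compactly supported `C¹` vector fields. -/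
theorem integral_divg_eq_zero {Y : 𝔼 → 𝔼} (hY : ContDiff ℝ 1 Y) (hc : HasCompactSupport Y) :
    ∫ x, divg Y x = 0 := by
  have h := hY.continuous_fderiv one_ne_zero
  have hint : ∀ i, Integrable (fun x => fderiv ℝ Y x (EuclideanSpace.single i 1)) := fun i =>
    Continuous.integrable_of_hasCompactSupport (by fun_prop) (hc.fderiv_apply ℝ _)
  have hzero : ∀ i, ∫ x, fderiv ℝ Y x (EuclideanSpace.single i 1) = 0 := fun i => by
    have := integral_smul_fderiv_eq_neg_fderiv_smul_of_integrable (μ := volume)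
      (f := fun _ : 𝔼 => (1 : ℝ)) (g := Y) (v := EuclideanSpace.single i 1) (by simp)
      (by simpa using hint i)
      (by simpa using hY.continuous.integrable_of_hasCompactSupport hc)
      (fun _ _ => by fun_prop) (fun x _ => hY.differentiable one_ne_zero x)
    simpa using this
  unfold divg
  have happ : ∀ i, ∫ x, fderiv ℝ Y x (EuclideanSpace.single i 1) i = 0 := fun i => by
    have := (EuclideanSpace.proj (𝕜 := ℝ) i : 𝔼 →L[ℝ] ℝ).integral_comp_comm (hint i)
    simpa [hzero i] using this
  have happ_int : ∀ i, Integrable (fun x => fderiv ℝ Y x (EuclideanSpace.single i 1) i) :=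
    fun i => (EuclideanSpace.proj (𝕜 := ℝ) i : 𝔼 →L[ℝ] ℝ).integrable_comp (hint i)
  rw [integral_finsetSum _ fun i _ => happ_int i]
  exact Finset.sum_eq_zero fun i _ => happ i

theorem gradient_fun_mul {v φ : 𝔼 → ℝ} {x : 𝔼} (hv : DifferentiableAt ℝ v x)
    (hφ : DifferentiableAt ℝ φ x) :
    gradient (fun y => v y * φ y) x = v x • gradient φ x + φ x • gradient v x := by
  simp [gradient, fderiv_fun_mul hv hφ]

theorem continuousAt_gradient {f : 𝔼 → ℝ} {x : 𝔼} (hf : ContDiffAt ℝ 1 f x) :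
    ContinuousAt (gradient f) x :=
  (InnerProductSpace.toDual ℝ 𝔼).symm.continuous.continuousAt.comp
    (hf.fderiv_right (m := 0) (by simp)).continuousAt

/-- Pointwise Picone-type inequality with remainder. -/
theorem picone_remainder {p : ℝ} (hp : 2 ≤ p) {v φ : 𝔼 → ℝ} {x : 𝔼}
    (hv : DifferentiableAt ℝ v x) (hφ : DifferentiableAt ℝ φ x) (hpos : 0 ≤ φ x)
    (hX : DifferentiableAt ℝ (fun y => ‖gradient φ y‖ ^ (p - 2) • gradient φ y) x) :
    2 * (1 / 2 : ℝ) ^ p * (‖gradient v x‖ ^ p * φ x ^ p)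
      + divg (fun y => (|v y| ^ p * φ y) • (‖gradient φ y‖ ^ (p - 2) • gradient φ y)) x
      ≤ ‖gradient (fun y => v y * φ y) x‖ ^ p + |v x| ^ p * φ x * pLap p φ x := by
  have hg := ((hasDerivAt_abs_rpow (v x) (p := p) (by linarith)).comp_hasFDerivAt x
    hv.hasFDerivAt).mul hφ.hasFDerivAt
  have hdiv := divg_smul hg hX
  have hdv : fderiv ℝ v x (gradient φ x) = inner ℝ (gradient φ x) (gradient v x) := by
    rw [← inner_gradient_left, real_inner_comm]
  have hdφ : fderiv ℝ φ x (gradient φ x) = ‖gradient φ x‖ ^ 2 := by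
    rw [← inner_gradient_left, real_inner_self_eq_norm_sq]
  have hnorm : ‖gradient φ x‖ ^ p = ‖gradient φ x‖ ^ (p - 2) * ‖gradient φ x‖ ^ 2 := by
    rw [← Real.rpow_two, ← Real.rpow_add_of_nonneg (norm_nonneg _) (by linarith) (by norm_num),
      sub_add_cancel]
  have key := norm_rpow_add_inner_add_le_norm_add_rpow hp (v x • gradient φ x)
    (φ x • gradient v x)
  rw [← gradient_fun_mul hv hφ] at key
  simp only [norm_smul, Real.mul_rpow, norm_nonneg, abs_nonneg, hpos, inner_smul_left,
    inner_smul_right, Real.norm_eq_abs, abs_of_nonneg hpos, hnorm, RCLike.conj_to_real] at key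
  simp only [Function.comp_apply, Pi.mul_apply, add_apply,
    smul_apply, map_smul, smul_eq_mul, hdv, hdφ] at hdiv
  change divg (fun y => (|v y| ^ p * φ y) • (‖gradient φ y‖ ^ (p - 2) • gradient φ y)) x = _
    at hdiv
  rw [hdiv]
  unfold pLap
  linarith

theorem continuousAt_gradient_rpow {f : 𝔼 → ℝ} {x : 𝔼} {p : ℝ} (hp : 0 ≤ p)
    (hf : ContDiffAt ℝ 1 f x) : ContinuousAt (fun y => ‖gradient f y‖ ^ p) x :=
  (continuousAt_gradient hf).norm.rpow_const (Or.inr hp)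

theorem contDiff_of_contDiffAt_of_mem_tsupport {F : Type*} [NormedAddCommGroup F]
    [NormedSpace ℝ F] {f : 𝔼 → F} {n : WithTop ℕ∞}
    (h : ∀ x ∈ tsupport f, ContDiffAt ℝ n f x) : ContDiff ℝ n f := by
  refine contDiff_iff_contDiffAt.2 fun x => ?_
  by_cases hx : x ∈ tsupport f
  · exact h x hx
  · exact (contDiffAt_const (c := (0 : F))).congr_of_eventuallyEq
      (notMem_tsupport_iff_eventuallyEq.1 hx)

theorem gradient_eq_zero_of_notMem_tsupport {f : 𝔼 → ℝ} {x : 𝔼} (hx : x ∉ tsupport f) :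
    gradient f x = 0 := by
  simp [gradient, image_eq_zero_of_notMem_tsupport fun h => hx (tsupport_fderiv_subset ℝ h)]

/-- A function vanishing off a compact set and continuous at each of its points is integrable. -/
theorem integrable_of_continuousAt_of_eq_zero {K : Set 𝔼} (hK : IsCompact K) {f : 𝔼 → ℝ}
    (hf : ∀ x ∈ K, ContinuousAt f x) (h0 : ∀ x ∉ K, f x = 0) : Integrable f := by
  have hsub : tsupport f ⊆ K :=
    closure_minimal (fun x hx => by_contra fun h => hx (h0 x h)) hK.isClosed
  exact (continuous_of_tsupport fun x hx => hf x (hsub hx)).integrable_of_hasCompactSupport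
    (HasCompactSupport.intro hK h0)
end

/-- if `φ > 0` on `ℝ^N` is `C²` away from the two poles and is a supersolution
of `-Δ_p φ ≥ V φ^{p-1}` there (with `V ∈ L¹_loc` continuous away from the poles), then there
is a constant `c₁(p) > 0`, depending only on `p`, such that for every
`u ∈ C_c^∞(ℝ^N \ {a₁, a₂})`:
`c₁(p) ∫ |∇(u/φ)|^p φ^p ≤ ∫ |∇u|^p - ∫ V |u|^p`. -/
theorem hardy_remainder_lemma (p : ℝ) (hp : 2 ≤ p) :
    ∃ c₁ : ℝ, 0 < c₁ ∧
      ∀ (N : ℕ), 3 ≤ N →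
      ∀ (a₁ a₂ : EuclideanSpace ℝ (Fin N)) (φ V : EuclideanSpace ℝ (Fin N) → ℝ),
        (∀ x, 0 < φ x) →
        ContDiffOn ℝ 2 φ ({a₁, a₂} : Set (EuclideanSpace ℝ (Fin N)))ᶜ →
        LocallyIntegrable V volume →
        ContinuousOn V ({a₁, a₂} : Set (EuclideanSpace ℝ (Fin N)))ᶜ →
        (∀ x ∉ ({a₁, a₂} : Set (EuclideanSpace ℝ (Fin N))),
          0 ≤ -pLap p φ x - V x * φ x ^ (p - 1)) →
        ∀ u : EuclideanSpace ℝ (Fin N) → ℝ, ContDiff ℝ (⊤ : ℕ∞) u → HasCompactSupport u →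
          tsupport u ⊆ ({a₁, a₂} : Set (EuclideanSpace ℝ (Fin N)))ᶜ →
          c₁ * ∫ x, ‖gradient (fun y => u y / φ y) x‖ ^ p * φ x ^ p ≤
            (∫ x, ‖gradient u x‖ ^ p) - ∫ x, V x * |u x| ^ p := by
  have hp0 : 0 ≤ p := by linarith
  have hp' : p ≠ 0 := by linarith
  refine ⟨2 * (1 / 2 : ℝ) ^ p, by positivity, ?_⟩
  intro N _ a₁ a₂ φ V hφ hφ2 _ hV hsup u hu huc hus
  set v : EuclideanSpace ℝ (Fin N) → ℝ := fun y => u y / φ y with hv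
  set X : EuclideanSpace ℝ (Fin N) → EuclideanSpace ℝ (Fin N) :=
    fun y => ‖gradient φ y‖ ^ (p - 2) • gradient φ y with hX
  set Y : EuclideanSpace ℝ (Fin N) → EuclideanSpace ℝ (Fin N) :=
    fun y => (|v y| ^ p * φ y) • X y with hY
  set Ω : Set (EuclideanSpace ℝ (Fin N)) := {a₁, a₂}ᶜ with hΩ
  have hΩo : IsOpen Ω := (Set.toFinite {a₁, a₂}).isClosed.isOpen_compl
  have hφΩ : ∀ x ∈ Ω, ContDiffAt ℝ 2 φ x := fun x hx => hφ2.contDiffAt (hΩo.mem_nhds hx)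
  have hvu : (fun y => v y * φ y) = u := funext fun y => div_mul_cancel₀ _ (hφ y).ne'
  have hφ1 : ∀ x ∈ Ω, ContDiffAt ℝ 1 φ x := fun x hx => (hφΩ x hx).of_le (by norm_num)
  have hu1 : ContDiff ℝ 1 u := hu.of_le (by exact_mod_cast le_top)
  have hv1 : ∀ x ∈ Ω, ContDiffAt ℝ 1 v x := fun x hx =>
    hu1.contDiffAt.div (hφ1 x hx) (hφ x).ne'
  have hX1 : ∀ x ∈ Ω, ContDiffAt ℝ 1 X x := fun x hx => by
    have hgrad : ContDiffAt ℝ 1 (gradient φ) x :=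
      (InnerProductSpace.toDual ℝ _).symm.contDiff.contDiffAt.comp x
        ((hφΩ x hx).fderiv_right (m := 1) (by norm_num))
    exact (contDiff_norm_rpow_smul (q := p - 2) (by linarith)).contDiffAt.comp x hgrad
  have hY1 : ∀ x ∈ Ω, ContDiffAt ℝ 1 Y x := fun x hx =>
    (((contDiff_norm_rpow (E := ℝ) (p := p) (by linarith)).contDiffAt.comp x (hv1 x hx)).mul
      (hφ1 x hx)).smul (hX1 x hx)
  have hvs : tsupport v ⊆ tsupport u :=
    closure_mono fun x hx h => hx (by simp [hv, h])
  have hYs : tsupport Y ⊆ tsupport u :=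
    closure_mono fun x hx h => hx (by simp [hY, hv, h, Real.zero_rpow hp'])
  have hYc : HasCompactSupport Y := huc.mono' (subset_closure.trans hYs)
  have hYd : ContDiff ℝ 1 Y :=
    contDiff_of_contDiffAt_of_mem_tsupport fun x hx => hY1 x (hus (hYs hx))
  have hIA : Integrable fun x => ‖gradient v x‖ ^ p * φ x ^ p := by
    refine integrable_of_continuousAt_of_eq_zero huc.isCompact (fun x hx => ?_) fun x hx => ?_
    · exact (continuousAt_gradient_rpow hp0 (hv1 x (hus hx))).mul
        ((hφ1 x (hus hx)).continuousAt.rpow_const (Or.inr hp0))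
    · simp [gradient_eq_zero_of_notMem_tsupport fun h => hx (hvs h), Real.zero_rpow hp']
  have hIB : Integrable fun x => ‖gradient u x‖ ^ p := by
    refine integrable_of_continuousAt_of_eq_zero huc.isCompact (fun x hx => ?_) fun x hx => ?_
    · exact continuousAt_gradient_rpow hp0 hu1.contDiffAt
    · simp [gradient_eq_zero_of_notMem_tsupport hx, Real.zero_rpow hp']
  have hIC : Integrable fun x => V x * |u x| ^ p := by
    refine integrable_of_continuousAt_of_eq_zero huc.isCompact (fun x hx => ?_) fun x hx => ?_
    · exact (hV.continuousAt (hΩo.mem_nhds (hus hx))).mul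
        (hu1.continuous.continuousAt.abs.rpow_const (Or.inr hp0))
    · simp [image_eq_zero_of_notMem_tsupport hx, Real.zero_rpow hp']
  have hpt : ∀ x, 2 * (1 / 2 : ℝ) ^ p * (‖gradient v x‖ ^ p * φ x ^ p) + divg Y x ≤
      ‖gradient u x‖ ^ p - V x * |u x| ^ p := by
    intro x
    by_cases hx : x ∈ tsupport u
    · have hxΩ := hus hx
      have h := picone_remainder hp ((hv1 x hxΩ).differentiableAt one_ne_zero)
        ((hφ1 x hxΩ).differentiableAt one_ne_zero) (hφ x).le
        ((hX1 x hxΩ).differentiableAt one_ne_zero)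
      rw [hvu] at h
      have hs := mul_nonneg (mul_nonneg (Real.rpow_nonneg (abs_nonneg (v x)) p) (hφ x).le)
        (hsup x hxΩ)
      have hup : |u x| ^ p = |v x| ^ p * φ x * φ x ^ (p - 1) := by
        rw [← hvu, abs_mul, abs_of_pos (hφ x), Real.mul_rpow (abs_nonneg _) (hφ x).le, mul_assoc,
          ← Real.rpow_one_add' (hφ x).le (by linarith), add_sub_cancel]
      rw [hup]
      linarith
    · rw [gradient_eq_zero_of_notMem_tsupport fun h => hx (hvs h),
        gradient_eq_zero_of_notMem_tsupport hx,
        divg_eq_zero_of_notMem_tsupport fun h => hx (hYs h), image_eq_zero_of_notMem_tsupport hx]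
      simp [Real.zero_rpow hp']
  calc 2 * (1 / 2 : ℝ) ^ p * ∫ x, ‖gradient v x‖ ^ p * φ x ^ p
      = ∫ x, (2 * (1 / 2 : ℝ) ^ p * (‖gradient v x‖ ^ p * φ x ^ p) + divg Y x) := by
        rw [integral_add (hIA.const_mul _) (integrable_divg hYd hYc), integral_const_mul,
          integral_divg_eq_zero hYd hYc, add_zero]
    _ ≤ ∫ x, (‖gradient u x‖ ^ p - V x * |u x| ^ p) :=
        integral_mono ((hIA.const_mul _).add (integrable_divg hYd hYc)) (hIB.sub hIC) hpt
    _ = _ := integral_sub hIB hIC
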